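/- Let I be the augmentation ideal of the integral group algebra R = ℤ[ℚ/ℤ] and let l be a prime. For every element θ ∈ I and all positive integers s and t, there exist η ∈ I and μ ∈ I^t such that θ = l^s·η + μ. -/

import Mathlib

noncomputable section

/-- The group `ℚ/ℤ`. -/
abbrev QZ : Type := AddCircle (1 : ℚ)

/-- The integral group algebra `ℤ[ℚ/ℤ]`. -/
abbrev RZ : Type := AddMonoidAlgebra ℤ QZ

/-- The augmentation ring homomorphism `ℤ[ℚ/ℤ] → ℤ`, sending every group element to `1`. -/
def eps : RZ →+* ℤ :=
  AddMonoidAlgebra.liftNCRingHom (RingHom.id ℤ) 1 (fun _ _ => Commute.one_right _)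

/-- The augmentation ideal `I = ker ε`. -/
def Iaug : Ideal RZ := RingHom.ker eps

/-- The first-order binomial expansion: `(1 + x) ^ n - 1` is `n * x` up to an element of `K ^ 2`. -/
theorem pow_sub_one_mem_span_mul_sup_sq {A : Type*} [CommRing A] (K : Ideal A) {u : A}
    (hu : u - 1 ∈ K) (n : ℕ) : u ^ n - 1 ∈ Ideal.span {(n : A)} * K ⊔ K ^ 2 := by
  suffices h : u ^ n - 1 - n * (u - 1) ∈ K ^ 2 by
    have hn : (n : A) * (u - 1) ∈ Ideal.span {(n : A)} * K :=
      Ideal.mul_mem_mul (Ideal.mem_span_singleton_self _) hu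
    have := add_mem (Ideal.mem_sup_left hn) (Ideal.mem_sup_right h)
    rwa [add_sub_cancel] at this
  induction n with
  | zero => simp
  | succ n ih =>
    have h₂ : (n : A) * (u - 1) ^ 2 ∈ K ^ 2 := Ideal.mul_mem_left _ _ (Ideal.pow_mem_pow hu 2)
    convert add_mem (Ideal.mul_mem_left _ u ih) h₂ using 1
    push_cast
    ring

/-- If `K = a K + K ^ 2`, then `K = a ^ s K + K ^ t` for all `s` and all `t ≥ 1`. -/
theorem Ideal.le_span_pow_mul_sup_pow {A : Type*} [CommRing A] {K : Ideal A} {a : A}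
    (h : K ≤ Ideal.span {a} * K ⊔ K ^ 2) (s : ℕ) {t : ℕ} (ht : 0 < t) :
    K ≤ Ideal.span {a ^ s} * K ⊔ K ^ t := by
  have h₁ : K ≤ Ideal.span {a} * K ⊔ K ^ t := by
    induction t, ht using Nat.le_induction with
    | base => simp
    | succ t _ ih =>
      refine h.trans (sup_le le_sup_left ?_)
      calc K ^ 2 = K * K := pow_two K
        _ ≤ K * (Ideal.span {a} * K ⊔ K ^ t) := Ideal.mul_mono_right ih
        _ = K * (Ideal.span {a} * K) ⊔ K ^ (t + 1) := by rw [Ideal.mul_sup, pow_succ']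
        _ ≤ Ideal.span {a} * K ⊔ K ^ (t + 1) := sup_le_sup_right Ideal.mul_le_right _
  induction s with
  | zero => simp
  | succ s ih =>
    refine h₁.trans (sup_le ?_ le_sup_right)
    calc Ideal.span {a} * K ≤ Ideal.span {a} * (Ideal.span {a ^ s} * K ⊔ K ^ t) :=
          Ideal.mul_mono_right ih
      _ = Ideal.span {a ^ (s + 1)} * K ⊔ Ideal.span {a} * K ^ t := by
          rw [Ideal.mul_sup, ← mul_assoc, Ideal.span_singleton_mul_span_singleton, ← pow_succ']
      _ ≤ Ideal.span {a ^ (s + 1)} * K ⊔ K ^ t := sup_le_sup_left Ideal.mul_le_right _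

theorem eps_single (g : QZ) (m : ℤ) : eps (AddMonoidAlgebra.single g m) = m := by
  simp [eps]

theorem single_sub_one_mem_Iaug (g : QZ) : AddMonoidAlgebra.single g (1 : ℤ) - 1 ∈ Iaug := by
  rw [Iaug, RingHom.mem_ker, map_sub, eps_single, map_one, sub_self]

/-- The augmentation ideal is generated by the elements `g - 1`. -/
theorem Iaug_le_of_single_sub_one_mem {J : Ideal RZ}
    (hJ : ∀ g : QZ, AddMonoidAlgebra.single g (1 : ℤ) - 1 ∈ J) : Iaug ≤ J := by
  suffices h : ∀ θ : RZ, θ - (eps θ : RZ) ∈ J by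
    intro θ hθ
    simpa [RingHom.mem_ker.mp hθ] using h θ
  intro θ
  induction θ using AddMonoidAlgebra.induction_linear with
  | zero => simp
  | add f g hf hg =>
    convert add_mem hf hg using 1
    rw [map_add, Int.cast_add]
    ring
  | single g m =>
    convert Ideal.mul_mem_left J (m : RZ) (hJ g) using 1
    rw [eps_single, mul_sub, mul_one, ← zsmul_eq_mul, AddMonoidAlgebra.smul_single, smul_eq_mul,
      mul_one]

theorem Iaug_le_span_natCast_mul_sup_sq {n : ℕ} (hn : n ≠ 0) :
    Iaug ≤ Ideal.span {(n : RZ)} * Iaug ⊔ Iaug ^ 2 := by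
  refine Iaug_le_of_single_sub_one_mem fun g => ?_
  obtain ⟨x, rfl⟩ := QuotientAddGroup.mk_surjective g
  convert pow_sub_one_mem_span_mul_sup_sq Iaug
    (single_sub_one_mem_Iaug ((x / n : ℚ) : QZ)) n using 2
  rw [AddMonoidAlgebra.single_pow, one_pow, ← AddCircle.coe_nsmul, nsmul_eq_mul,
    mul_div_cancel₀ x (Nat.cast_ne_zero.mpr hn)]

/-- For a prime `l`, every `θ ∈ I` and all positive integers `s`, `t`, there are
`η ∈ I` and `μ ∈ I^t` with `θ = l^s·η + μ`. -/
theorem augmentation_ideal_decomposition (l : ℕ) (hl : l.Prime) :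
    ∀ θ ∈ Iaug, ∀ s t : ℕ, 0 < s → 0 < t →
      ∃ η ∈ Iaug, ∃ μ ∈ Iaug ^ t, θ = (l : RZ) ^ s * η + μ := by
  intro θ hθ s t _ ht
  obtain ⟨y, hy, μ, hμ, rfl⟩ := Submodule.mem_sup.mp
    (Ideal.le_span_pow_mul_sup_pow (Iaug_le_span_natCast_mul_sup_sq hl.ne_zero) s ht hθ)
  obtain ⟨η, hη, rfl⟩ := Ideal.mem_span_singleton_mul.mp hy
  exact ⟨η, hη, μ, hμ, rfl⟩
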